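/- arXiv:2211.07133 — 7 statements merged into one kernel-verified Lean document; each statement's English description precedes it below -/
import Mathlib

section
/- Let κ ∈ (0,1) and fix k ∈ ℕ. There exists a constant a_k > 0, depending only on k and κ, such that for every N ∈ ℕ with N ≥ 2 and every N₁, N₂ ∈ ℕ with N₁ + N₂ = N, κ·N ≤ N₁ < N, κ·N ≤ N₂ < N, and for every j ∈ {0,1,…,k}, one has | binom(N,k)⁻¹ · binom(N₁, k−j) · binom(N₂, j) − binom(k,j) · N₁^{k−j} · N₂^{j} / N^{k} | ≤ a_k / N, where the expression is evaluated in ℝ. -/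
open scoped BigOperators

theorem mul_pow_le_mul_descFactorial_add {n N : ℕ} (h : n ≤ N) (m : ℕ) :
    N * n ^ m ≤ N * n.descFactorial m + m ^ 2 * N ^ m := by
  induction m with
  | zero => simp
  | succ m ih =>
    have h1 : n ≤ (n - m) + m := by omega
    have h2 : n.descFactorial m ≤ N ^ m :=
      (Nat.descFactorial_le_pow n m).trans (Nat.pow_le_pow_left h m)
    rw [Nat.descFactorial_succ]
    calc N * n ^ (m + 1) = N * n ^ m * n := by ring
      _ ≤ (N * n.descFactorial m + m ^ 2 * N ^ m) * n := by gcongr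
      _ = N * n.descFactorial m * n + m ^ 2 * N ^ m * n := by ring
      _ ≤ N * n.descFactorial m * ((n - m) + m) + m ^ 2 * N ^ m * N := by gcongr
      _ = N * ((n - m) * n.descFactorial m) + m * N * n.descFactorial m
            + m ^ 2 * N ^ m * N := by ring
      _ ≤ N * ((n - m) * n.descFactorial m) + m * N * N ^ m + m ^ 2 * N ^ m * N := by gcongr
      _ = N * ((n - m) * n.descFactorial m) + (m + m ^ 2) * N ^ (m + 1) := by ring
      _ ≤ N * ((n - m) * n.descFactorial m) + (m + 1) ^ 2 * N ^ (m + 1) := by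
        gcongr
        nlinarith

theorem mul_pow_mul_pow_le_mul_descFactorial_add {m n N : ℕ} (hm : m ≤ N) (hn : n ≤ N)
    (a b : ℕ) :
    N * (m ^ a * n ^ b) ≤
      N * (m.descFactorial a * n.descFactorial b) + (a + b) ^ 2 * N ^ (a + b) := by
  have h1 : m.descFactorial a ≤ N ^ a :=
    (Nat.descFactorial_le_pow m a).trans (Nat.pow_le_pow_left hm a)
  calc N * (m ^ a * n ^ b) = N * m ^ a * n ^ b := by ring
    _ ≤ (N * m.descFactorial a + a ^ 2 * N ^ a) * n ^ b := by
      gcongr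
      exact mul_pow_le_mul_descFactorial_add hm a
    _ = m.descFactorial a * (N * n ^ b) + a ^ 2 * N ^ a * n ^ b := by ring
    _ ≤ m.descFactorial a * (N * n.descFactorial b + b ^ 2 * N ^ b) + a ^ 2 * N ^ a * N ^ b := by
      gcongr
      exact mul_pow_le_mul_descFactorial_add hn b
    _ = N * (m.descFactorial a * n.descFactorial b) + m.descFactorial a * (b ^ 2 * N ^ b)
          + a ^ 2 * N ^ a * N ^ b := by ring
    _ ≤ N * (m.descFactorial a * n.descFactorial b) + N ^ a * (b ^ 2 * N ^ b)
          + a ^ 2 * N ^ a * N ^ b := by gcongr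
    _ = N * (m.descFactorial a * n.descFactorial b) + (a ^ 2 + b ^ 2) * N ^ (a + b) := by ring
    _ ≤ N * (m.descFactorial a * n.descFactorial b) + (a + b) ^ 2 * N ^ (a + b) := by
      gcongr
      nlinarith [Nat.zero_le (a * b)]

theorem choose_mul_choose_le_choose_add (m n a b : ℕ) :
    m.choose a * n.choose b ≤ (m + n).choose (a + b) := by
  rw [Nat.add_choose_eq]
  exact Finset.single_le_sum (f := fun p : ℕ × ℕ => m.choose p.1 * n.choose p.2)
    (fun _ _ => Nat.zero_le _) (show (a, b) ∈ Finset.HasAntidiagonal.antidiagonal (a + b) by simp)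

theorem choose_mul_choose_mul_descFactorial (m n N a b : ℕ) :
    m.choose a * n.choose b * N.descFactorial (a + b) =
      N.choose (a + b) * ((a + b).choose b * (m.descFactorial a * n.descFactorial b)) := by
  have h := Nat.add_choose_mul_factorial_mul_factorial a b
  simp only [Nat.descFactorial_eq_factorial_mul_choose]
  rw [← h]
  ring

theorem abs_choose_quotient_sub_le (m n a b : ℕ) (hN : 0 < m + n) :
    |(((m + n).choose (a + b) : ℝ))⁻¹ * (m.choose a : ℝ) * (n.choose b : ℝ)
        - ((a + b).choose b : ℝ) * (m : ℝ) ^ a * (n : ℝ) ^ b / ((m + n : ℕ) : ℝ) ^ (a + b)|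
      ≤ (2 ^ (a + b) * (a + b : ℕ) ^ 2) / ((m + n : ℕ) : ℝ) := by
  have hle := choose_mul_choose_le_choose_add m n a b
  have hmul := choose_mul_choose_mul_descFactorial m n (m + n) a b
  have hprod := mul_pow_mul_pow_le_mul_descFactorial_add
    (Nat.le_add_right m n) (Nat.le_add_left n m) a b
  have hpow := mul_pow_le_mul_descFactorial_add (le_refl (m + n)) (a + b)
  have hprod' : m.descFactorial a * n.descFactorial b ≤ m ^ a * n ^ b :=
    Nat.mul_le_mul (Nat.descFactorial_le_pow m a) (Nat.descFactorial_le_pow n b)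
  have hpow' := Nat.descFactorial_le_pow (m + n) (a + b)
  have hB := Nat.choose_le_two_pow (a + b) b
  have hzero : (m + n).choose (a + b) = 0 → m.descFactorial a * n.descFactorial b = 0 := by
    intro h
    rw [Nat.descFactorial_eq_factorial_mul_choose, Nat.descFactorial_eq_factorial_mul_choose,
      mul_mul_mul_comm, Nat.le_zero.1 (hle.trans h.le), mul_zero]
  generalize m + n = N at *
  generalize a + b = k at *
  generalize m.descFactorial a * n.descFactorial b = P' at *
  generalize N.descFactorial k = D at *
  generalize k.choose b = B at *
  have hN' : (0 : ℝ) < N := by exact_mod_cast hN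
  set x : ℝ := ((N.choose k : ℝ))⁻¹ * (m.choose a : ℝ) * (n.choose b : ℝ) with hx
  have hx0 : 0 ≤ x := by positivity
  have hx1 : x ≤ 1 := by
    rw [hx, mul_assoc]
    exact inv_mul_le_one_of_le₀ (by exact_mod_cast hle) (by positivity)
  have hxD : x * D = B * P' := by
    rcases Nat.eq_zero_or_pos (N.choose k) with h | h
    · simp [hx, h, hzero h]
    · have h' : (N.choose k : ℝ) ≠ 0 := by positivity
      have hmul' : (m.choose a * n.choose b * D : ℝ) = N.choose k * (B * P') := by
        exact_mod_cast hmul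
      rw [hx]
      field_simp
      linarith
  have hprodR : (N : ℝ) * (m ^ a * n ^ b) ≤ N * P' + k ^ 2 * N ^ k := by exact_mod_cast hprod
  have hprodR' : (P' : ℝ) ≤ m ^ a * n ^ b := by exact_mod_cast hprod'
  have hpowR : (N : ℝ) * N ^ k ≤ N * D + k ^ 2 * N ^ k := by exact_mod_cast hpow
  have hpowR' : (D : ℝ) ≤ N ^ k := by exact_mod_cast hpow'
  have hBR : (B : ℝ) ≤ 2 ^ k := by exact_mod_cast hB
  have hB0 : (0 : ℝ) ≤ B := by positivity
  have key : x - B * (m : ℝ) ^ a * (n : ℝ) ^ b / (N : ℝ) ^ k =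
      (x * (N * N ^ k - N * D) - B * (N * (m ^ a * n ^ b) - N * P')) / (N ^ k * N) := by
    field_simp
    linear_combination hxD
  have hRHS : (2 ^ k * (k : ℝ) ^ 2) / N = 2 ^ k * (k ^ 2 * N ^ k) / (N ^ k * N) := by
    field_simp
  rw [key, hRHS, abs_div, abs_of_pos (show (0 : ℝ) < N ^ k * N by positivity)]
  gcongr
  have h2 : (1 : ℝ) ≤ 2 ^ k := one_le_pow₀ (by norm_num)
  have hu0 : 0 ≤ x * ((N : ℝ) * N ^ k - N * D) :=
    mul_nonneg hx0 (sub_nonneg.2 (by gcongr))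
  have hu : x * ((N : ℝ) * N ^ k - N * D) ≤ 2 ^ k * (k ^ 2 * N ^ k) :=
    mul_le_mul (hx1.trans h2) (by linarith) (sub_nonneg.2 (by gcongr)) (by positivity)
  have hv0 : 0 ≤ B * ((N : ℝ) * (m ^ a * n ^ b) - N * P') :=
    mul_nonneg hB0 (sub_nonneg.2 (by gcongr))
  have hv : B * ((N : ℝ) * (m ^ a * n ^ b) - N * P') ≤ 2 ^ k * (k ^ 2 * N ^ k) :=
    mul_le_mul hBR (by linarith) (sub_nonneg.2 (by gcongr)) (by positivity)
  exact abs_le.2 ⟨by linarith, by linarith⟩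

/-- for `κ ∈ (0,1)` and fixed `k`, there is `a_k > 0` such that for all
`N ≥ 2`, `N₁ + N₂ = N` with `κN ≤ N₁ < N`, `κN ≤ N₂ < N`, and all `j ∈ {0,…,k}`,
`|binom(N,k)⁻¹ binom(N₁,k−j) binom(N₂,j) − binom(k,j) N₁^{k−j} N₂^{j} / N^{k}| ≤ a_k / N`. -/
theorem stmt1 (κ : ℝ) (hκ : κ ∈ Set.Ioo (0 : ℝ) 1) (k : ℕ) :
    ∃ a : ℝ, 0 < a ∧
      ∀ N N₁ N₂ : ℕ, 2 ≤ N → N₁ + N₂ = N →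
        κ * N ≤ (N₁ : ℝ) → N₁ < N → κ * N ≤ (N₂ : ℝ) → N₂ < N →
        ∀ j : ℕ, j ≤ k →
          |((N.choose k : ℝ))⁻¹ * (N₁.choose (k - j) : ℝ) * (N₂.choose j : ℝ)
              - (k.choose j : ℝ) * (N₁ : ℝ) ^ (k - j) * (N₂ : ℝ) ^ j / (N : ℝ) ^ k|
            ≤ a / N := by
  refine ⟨2 ^ k * (k : ℝ) ^ 2 + 1, by positivity, ?_⟩
  rintro _ N₁ N₂ hN rfl _ _ _ _ j hj
  have h := abs_choose_quotient_sub_le N₁ N₂ (k - j) j (by omega)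
  rw [Nat.sub_add_cancel hj] at h
  refine h.trans ?_
  gcongr
  linarith
end

section
/- Let ℓ ∈ ℕ with ℓ ≥ 2, let κ ∈ (0,1), and fix k ∈ ℕ. There exists a constant a_k > 0, depending only on k, ℓ and κ, such that for every N ∈ ℕ with N ≥ 2, every N₁, …, N_ℓ ∈ ℕ with N₁ + ⋯ + N_ℓ = N and κ·N ≤ N_p < N for each p ∈ {1,…,ℓ}, and every tuple a = (a₁,…,a_ℓ) of natural numbers with a₁ + ⋯ + a_ℓ = k, one has | binom(N,k)⁻¹ · ∏_{p=1}^{ℓ} binom(N_p, a_p) − (k! / (a₁!⋯a_ℓ!)) · ∏_{p=1}^{ℓ} N_p^{a_p} / N^{k} | ≤ a_k / N, where the expression is evaluated in ℝ. -/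
open scoped BigOperators

/-- A falling factorial of `n ≤ N` differs from the power `n ^ a` by at most `a ^ 2 / N`,
relative to `N ^ a`. -/
lemma pow_sub_descFactorial_mul_le {n N : ℕ} (h : n ≤ N) (a : ℕ) :
    ((n : ℝ) ^ a - (n.descFactorial a : ℝ)) * N ≤ (a : ℝ) ^ 2 * (N : ℝ) ^ a := by
  induction a with
  | zero => simp
  | succ a ih =>
    have hn : (n : ℝ) ≤ N := by exact_mod_cast h
    have hsub : (n : ℝ) - a ≤ ((n - a : ℕ) : ℝ) := by
      rw [sub_le_iff_le_add]
      exact_mod_cast (by omega : n ≤ n - a + a)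
    have hD : (n.descFactorial a : ℝ) ≤ (N : ℝ) ^ a := by
      exact_mod_cast (Nat.descFactorial_le_pow n a).trans (Nat.pow_le_pow_left h a)
    have hpow : (n.descFactorial a : ℝ) ≤ (n : ℝ) ^ a := by
      exact_mod_cast Nat.descFactorial_le_pow n a
    rw [Nat.descFactorial_succ]
    push_cast
    calc ((n : ℝ) ^ (a + 1) - ((n - a : ℕ) : ℝ) * (n.descFactorial a : ℝ)) * N
        ≤ ((n : ℝ) ^ (a + 1) - ((n : ℝ) - a) * (n.descFactorial a : ℝ)) * N := by gcongr
      _ = n * (((n : ℝ) ^ a - (n.descFactorial a : ℝ)) * N)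
            + a * (n.descFactorial a : ℝ) * N := by ring
      _ ≤ N * ((a : ℝ) ^ 2 * (N : ℝ) ^ a) + a * (N : ℝ) ^ a * N := by
          gcongr
      _ = ((a : ℝ) ^ 2 + a) * (N : ℝ) ^ (a + 1) := by ring
      _ ≤ ((a : ℝ) + 1) ^ 2 * (N : ℝ) ^ (a + 1) := by
          gcongr
          nlinarith

lemma prod_sub_prod_le_sum_sub {ι : Type*} (s : Finset ι) (x y : ι → ℝ)
    (hy : ∀ i, 0 ≤ y i) (hyx : ∀ i, y i ≤ x i) (hx : ∀ i, x i ≤ 1) :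
    ∏ i ∈ s, x i - ∏ i ∈ s, y i ≤ ∑ i ∈ s, (x i - y i) := by
  classical
  induction s using Finset.induction_on with
  | empty => simp
  | insert i s hi ih =>
    rw [Finset.prod_insert hi, Finset.prod_insert hi, Finset.sum_insert hi]
    have hX : ∏ j ∈ s, x j ≤ 1 :=
      Finset.prod_le_one (fun j _ => (hy j).trans (hyx j)) fun j _ => hx j
    have hX0 : ∏ j ∈ s, y j ≤ ∏ j ∈ s, x j :=
      Finset.prod_le_prod (fun j _ => hy j) fun j _ => hyx j
    have h1 := mul_le_mul_of_nonneg_left hX (sub_nonneg.2 (hyx i))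
    have h2 := mul_le_mul_of_nonneg_right ((hyx i).trans (hx i)) (sub_nonneg.2 hX0)
    linarith

lemma abs_div_sub_le {X Y Z u v : ℝ} (hX0 : 0 ≤ X) (hX1 : X ≤ 1) (hYX : Y ≤ X)
    (hu : X - Y ≤ u) (hZ1 : Z ≤ 1) (hv : 1 - Z ≤ v) (hZ : 1 / 2 ≤ Z) :
    |Y / Z - X| ≤ 2 * (u + v) := by
  have hZ0 : 0 < Z := by linarith
  have h1 := mul_le_mul_of_nonneg_right hX1 (sub_nonneg.2 hZ1)
  have h2 := mul_nonneg hX0 (sub_nonneg.2 hZ1)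
  have huv : 0 ≤ u + v := by linarith
  have h3 : u + v ≤ 2 * (u + v) * Z := by nlinarith
  rw [div_sub' hZ0.ne', abs_div, abs_of_pos hZ0, div_le_iff₀ hZ0, abs_le]
  constructor <;> linarith

/-- ℓ-level generalisation of the combinatorial comparison between
hypergeometric weights `binom(N,k)⁻¹ ∏ binom(N_p, a_p)` and multinomial weights
`(k!/(a₁!⋯a_ℓ!)) ∏ N_p^{a_p} / N^k`. -/
theorem stmt2 (ℓ : ℕ) (hℓ : 2 ≤ ℓ) (κ : ℝ) (hκ : κ ∈ Set.Ioo (0 : ℝ) 1) (k : ℕ) :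
    ∃ a : ℝ, 0 < a ∧
      ∀ N : ℕ, 2 ≤ N → ∀ Npop : Fin ℓ → ℕ, (∑ p, Npop p) = N →
        (∀ p : Fin ℓ, κ * N ≤ (Npop p : ℝ) ∧ Npop p < N) →
        ∀ aTup : Fin ℓ → ℕ, (∑ p, aTup p) = k →
          |((N.choose k : ℝ))⁻¹ * (∏ p, ((Npop p).choose (aTup p) : ℝ))
              - ((k.factorial : ℝ) / ∏ p, ((aTup p).factorial : ℝ))
                  * (∏ p, (Npop p : ℝ) ^ (aTup p)) / (N : ℝ) ^ k|
            ≤ a / N := by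
  refine ⟨((2 * (k : ℝ) ^ 2) ^ k + k.factorial) * (2 * (k : ℝ) ^ 2)
    + k.factorial * (2 * (ℓ * (k : ℝ) ^ 2 + (k : ℝ) ^ 2)) + 1, by positivity, ?_⟩
  intro N hN n hn hnN a ha
  have hN0 : (0 : ℝ) < N := by exact_mod_cast (by omega : 0 < N)
  have hle : ∀ p, n p ≤ N := fun p => (hnN p).2.le
  have hak : ∀ p, a p ≤ k := fun p =>
    ha ▸ Finset.single_le_sum (f := a) (fun _ _ => Nat.zero_le _) (Finset.mem_univ p)
  have hNk : (N : ℝ) ^ k = ∏ p, (N : ℝ) ^ a p := by rw [Finset.prod_pow_eq_pow_sum, ha]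
  have hq : ∏ p, (n p : ℝ) ^ a p ≤ (N : ℝ) ^ k := by
    rw [hNk]
    refine Finset.prod_le_prod (fun _ _ => by positivity) fun p _ => ?_
    exact_mod_cast Nat.pow_le_pow_left (hle p) _
  have hC1 : (1 : ℝ) ≤ ∏ p, ((a p).factorial : ℝ) := by
    exact_mod_cast Nat.one_le_iff_ne_zero.2
      (Finset.prod_ne_zero_iff.2 fun p _ => (a p).factorial_ne_zero)
  have hC : (k.factorial : ℝ) / ∏ p, ((a p).factorial : ℝ) ≤ k.factorial :=
    div_le_self (by positivity) hC1
  have hC0 : 0 ≤ (k.factorial : ℝ) / ∏ p, ((a p).factorial : ℝ) := by positivity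
  have hX1 : (∏ p, (n p : ℝ) ^ a p) / (N : ℝ) ^ k ≤ 1 := div_le_one_of_le₀ hq (by positivity)
  have hX0 : 0 ≤ (∏ p, (n p : ℝ) ^ a p) / (N : ℝ) ^ k := by positivity
  rw [le_div_iff₀ hN0, mul_div_assoc]
  by_cases hlarge : 2 * (k : ℝ) ^ 2 ≤ N
  · have key : |((∏ p, ((n p).descFactorial (a p) : ℝ)) / (N : ℝ) ^ k)
          / ((N.descFactorial k : ℝ) / (N : ℝ) ^ k) - (∏ p, (n p : ℝ) ^ a p) / (N : ℝ) ^ k|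
        ≤ 2 * (ℓ * (k : ℝ) ^ 2 / N + (k : ℝ) ^ 2 / N) := by
      have hv : 1 - (N.descFactorial k : ℝ) / (N : ℝ) ^ k ≤ (k : ℝ) ^ 2 / N := by
        have h := pow_sub_descFactorial_mul_le (le_refl N) k
        rw [one_sub_div (by positivity), div_le_div_iff₀ (by positivity) hN0]
        exact h
      have hhalf : (k : ℝ) ^ 2 / N ≤ 1 / 2 := by
        rw [div_le_iff₀ hN0]
        linarith
      refine abs_div_sub_le hX0 hX1 ?_ ?_ ?_ hv (by linarith)
      · gcongr with p
        exact_mod_cast Nat.descFactorial_le_pow _ _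
      · rw [hNk, ← Finset.prod_div_distrib, ← Finset.prod_div_distrib]
        refine (prod_sub_prod_le_sum_sub _ _ _ (fun p => by positivity) (fun p => ?_)
          (fun p => ?_)).trans ?_
        · gcongr
          exact_mod_cast Nat.descFactorial_le_pow _ _
        · refine div_le_one_of_le₀ ?_ (by positivity)
          exact_mod_cast Nat.pow_le_pow_left (hle p) _
        · have hterm : ∀ p ∈ Finset.univ, (n p : ℝ) ^ a p / (N : ℝ) ^ a p
              - ((n p).descFactorial (a p) : ℝ) / (N : ℝ) ^ a p ≤ (k : ℝ) ^ 2 / N := by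
            intro p _
            have h := pow_sub_descFactorial_mul_le (hle p) (a p)
            have hk : (a p : ℝ) ≤ k := by exact_mod_cast hak p
            rw [← sub_div, div_le_div_iff₀ (by positivity) hN0]
            refine h.trans ?_
            gcongr
          refine (Finset.sum_le_sum hterm).trans_eq ?_
          simp [mul_div_assoc]
      · refine div_le_one_of_le₀ ?_ (by positivity)
        exact_mod_cast Nat.descFactorial_le_pow N k
    have hrw : ((N.choose k : ℝ))⁻¹ * (∏ p, ((n p).choose (a p) : ℝ))
        = ((k.factorial : ℝ) / ∏ p, ((a p).factorial : ℝ))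
          * (((∏ p, ((n p).descFactorial (a p) : ℝ)) / (N : ℝ) ^ k)
          / ((N.descFactorial k : ℝ) / (N : ℝ) ^ k)) := by
      have hkf : (k.factorial : ℝ) ≠ 0 := by positivity
      simp only [Nat.descFactorial_eq_factorial_mul_choose, Nat.cast_mul,
        Finset.prod_mul_distrib]
      rw [div_div_div_cancel_right₀ (by positivity), mul_div_mul_comm, ← mul_assoc,
        div_mul_div_cancel₀ (by positivity), div_self hkf, one_mul, div_eq_inv_mul]
    rw [hrw, ← mul_sub, abs_mul, abs_of_nonneg hC0]
    have h := mul_le_mul hC key (abs_nonneg _) (by positivity)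
    have h2 := mul_le_mul_of_nonneg_right h hN0.le
    have h3 : (k.factorial : ℝ) * (2 * (ℓ * (k : ℝ) ^ 2 / N + (k : ℝ) ^ 2 / N)) * N
        = k.factorial * (2 * (ℓ * (k : ℝ) ^ 2 + (k : ℝ) ^ 2)) := by
      field_simp
    have h4 : 0 ≤ ((2 * (k : ℝ) ^ 2) ^ k + k.factorial) * (2 * (k : ℝ) ^ 2) := by positivity
    linarith
  · push Not at hlarge
    have hA0 : 0 ≤ ((N.choose k : ℝ))⁻¹ * (∏ p, ((n p).choose (a p) : ℝ)) := by positivity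
    have hinv : ((N.choose k : ℝ))⁻¹ ≤ 1 := Nat.cast_inv_le_one _
    have hprod : ∏ p, ((n p).choose (a p) : ℝ) ≤ (2 * (k : ℝ) ^ 2) ^ k := by
      refine (Finset.prod_le_prod (fun _ _ => by positivity) fun p _ => ?_).trans
        (hq.trans (by gcongr))
      exact_mod_cast Nat.choose_le_pow (n p) (a p)
    have hA := mul_le_mul hinv hprod (by positivity) zero_le_one
    have hB := mul_le_mul hC hX1 hX0 (by positivity)
    have hB0 := mul_nonneg hC0 hX0
    have habs : |((N.choose k : ℝ))⁻¹ * (∏ p, ((n p).choose (a p) : ℝ))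
        - (k.factorial : ℝ) / (∏ p, ((a p).factorial : ℝ))
          * ((∏ p, (n p : ℝ) ^ a p) / (N : ℝ) ^ k)| ≤ (2 * (k : ℝ) ^ 2) ^ k + k.factorial := by
      rw [abs_le]
      constructor <;> linarith
    have h := mul_le_mul habs hlarge.le hN0.le (by positivity)
    have h4 : 0 ≤ (k.factorial : ℝ) * (2 * (ℓ * (k : ℝ) ^ 2 + (k : ℝ) ^ 2)) := by positivity
    linarith
end

section
/- Let N, N₁, N₂, k ∈ ℕ with N = N₁ + N₂, N ≥ 2, and 1 ≤ k ≤ N−1. Let Ψ_N : (Fin N → Fin 2) → ℂ be defined by Ψ_N(σ) = (binom(N,N₁) : ℝ)^{−1/2} if cnt(σ) = N₂ and Ψ_N(σ) = 0 otherwise. Let γ^{(k)} be the matrix indexed by (Fin k → Fin 2) with entries γ^{(k)}(σ,τ) = Σ_{ρ : Fin (N−k) → Fin 2} Ψ_N(σ⌢ρ) · conj(Ψ_N(τ⌢ρ)). Then for all σ, τ : Fin k → Fin 2 one has γ^{(k)}(σ,τ) = Σ_{j=0}^{k} c_{k,j} · v_{k,j}(σ) · conj(v_{k,j}(τ)), where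 c_{k,j} = binom(N₁, k−j) · binom(N₂, j) / binom(N,k). -/
open scoped BigOperators
open ComplexConjugate

noncomputable section

/-- Number of indices `i` with `σ i = 1`. -/
def cnt {m : ℕ} (σ : Fin m → Fin 2) : ℕ :=
  (Finset.univ.filter fun i => σ i = 1).card

/-- Coordinate vector of the normalized symmetric tensor `e₁^{⊗(k−j)} ∨ e₂^{⊗j}`. -/
def vkj (k j : ℕ) (σ : Fin k → Fin 2) : ℂ :=
  if cnt σ = j then (((Real.sqrt (Nat.choose k j))⁻¹ : ℝ) : ℂ) else 0

/-- Coordinate vector of the fragmented state `φ₁^{⊗N₁} ∨ φ₂^{⊗N₂}`. -/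
def Psi (N N₁ N₂ : ℕ) (σ : Fin N → Fin 2) : ℂ :=
  if cnt σ = N₂ then (((Real.sqrt (Nat.choose N N₁))⁻¹ : ℝ) : ℂ) else 0

/-- Concatenation `σ⌢ρ : Fin N → α` via the canonical equivalence `Fin N ≃ Fin k ⊕ Fin (N−k)`. -/
def concat {α : Type*} {N k : ℕ} (h : k ≤ N) (σ : Fin k → α) (ρ : Fin (N - k) → α) :
    Fin N → α :=
  fun i => Fin.append σ ρ (Fin.cast (by omega) i)

theorem cnt_eq_sum {m : ℕ} (σ : Fin m → Fin 2) : cnt σ = ∑ i, if σ i = 1 then 1 else 0 := by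
  simp [cnt]

theorem cnt_le {m : ℕ} (σ : Fin m → Fin 2) : cnt σ ≤ m :=
  (Finset.card_filter_le _ _).trans_eq (Finset.card_fin m)

theorem cnt_comp_cast {m n : ℕ} (h : n = m) (σ : Fin m → Fin 2) :
    cnt (fun i => σ (Fin.cast h i)) = cnt σ := by
  subst h
  rfl

theorem cnt_append {m n : ℕ} (σ : Fin m → Fin 2) (ρ : Fin n → Fin 2) :
    cnt (Fin.append σ ρ) = cnt σ + cnt ρ := by
  simp only [cnt_eq_sum, Fin.sum_univ_add, Fin.append_left, Fin.append_right]

theorem cnt_concat {N k : ℕ} (h : k ≤ N) (σ : Fin k → Fin 2) (ρ : Fin (N - k) → Fin 2) :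
    cnt (concat h σ ρ) = cnt σ + cnt ρ :=
  (cnt_comp_cast (by omega) (Fin.append σ ρ)).trans (cnt_append σ ρ)

theorem card_filter_cnt_eq (m r : ℕ) :
    (Finset.univ.filter fun ρ : Fin m → Fin 2 => cnt ρ = r).card = m.choose r := by
  rw [← Finset.card_fin m, ← Finset.card_powersetCard, Finset.card_fin]
  refine Finset.card_nbij' (fun ρ => Finset.univ.filter fun i => ρ i = 1)
    (fun s i => if i ∈ s then 1 else 0) ?_ ?_ ?_ ?_
  · intro ρ hρ
    rw [Finset.mem_coe, Finset.mem_filter] at hρ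
    simpa [cnt, Finset.mem_powersetCard] using hρ.2
  · intro s hs
    rw [Finset.mem_coe, Finset.mem_filter]
    simpa [cnt, Finset.mem_powersetCard] using hs
  · intro ρ _
    funext i
    rcases Fin.exists_fin_two.mp ⟨ρ i, rfl⟩ with h | h <;> simp [h]
  · intro s _
    ext i
    simp

theorem choose_mul_choose_sub_comm (M a b : ℕ) :
    M.choose a * (M - a).choose b = M.choose b * (M - b).choose a := by
  have h₁ := Nat.choose_mul (n := M) (Nat.le_add_right a b)
  have h₂ := Nat.choose_mul (n := M) (Nat.le_add_left b a)
  rw [Nat.add_sub_cancel_left] at h₁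
  rw [Nat.add_sub_cancel] at h₂
  rw [← h₁, ← h₂, Nat.choose_symm_add]

theorem choose_sub_mul_choose_mul_choose {N₁ N₂ k j : ℕ} (hjk : j ≤ k) (hj : j ≤ N₂) :
    (N₁ + N₂ - k).choose (N₂ - j) * ((N₁ + N₂).choose k * k.choose j) =
      (N₁ + N₂).choose N₁ * (N₁.choose (k - j) * N₂.choose j) := by
  have h := choose_mul_choose_sub_comm (N₁ + N₂ - j) (k - j) (N₂ - j)
  rw [show N₁ + N₂ - j - (k - j) = N₁ + N₂ - k by omega,
    show N₁ + N₂ - j - (N₂ - j) = N₁ by omega] at h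
  have h' := Nat.choose_mul (n := N₁ + N₂) hj
  rw [← Nat.choose_symm_add] at h'
  rw [Nat.choose_mul hjk, mul_left_comm, mul_comm ((N₁ + N₂ - k).choose _), h,
    ← mul_assoc, ← h']
  ring

theorem ofReal_inv_sqrt_mul_conj (n : ℕ) :
    (((Real.sqrt n)⁻¹ : ℝ) : ℂ) * conj (((Real.sqrt n)⁻¹ : ℝ) : ℂ) = (n : ℂ)⁻¹ := by
  rw [Complex.conj_ofReal, ← Complex.ofReal_mul, ← mul_inv, Real.mul_self_sqrt n.cast_nonneg]
  simp

theorem sum_Psi_mul_conj_eq {N N₁ N₂ k : ℕ} (h : k ≤ N) (σ τ : Fin k → Fin 2) :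
    (∑ ρ : Fin (N - k) → Fin 2, Psi N N₁ N₂ (concat h σ ρ) * conj (Psi N N₁ N₂ (concat h τ ρ))) =
      if cnt σ = cnt τ ∧ cnt σ ≤ N₂ then
        ((N - k).choose (N₂ - cnt σ) : ℂ) * (N.choose N₁ : ℂ)⁻¹ else 0 := by
  have key (ρ : Fin (N - k) → Fin 2) :
      Psi N N₁ N₂ (concat h σ ρ) * conj (Psi N N₁ N₂ (concat h τ ρ)) =
        if cnt σ = cnt τ ∧ cnt σ ≤ N₂ then
          if cnt ρ = N₂ - cnt σ then (N.choose N₁ : ℂ)⁻¹ else 0 else 0 := by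
    simp only [Psi, cnt_concat]
    rw [← ofReal_inv_sqrt_mul_conj]
    split_ifs <;> first | omega | simp
  simp only [key]
  split_ifs
  · rw [← Finset.sum_filter, Finset.sum_const, card_filter_cnt_eq, nsmul_eq_mul]
  · simp

theorem sum_mul_vkj_mul_conj_eq {k : ℕ} (c : ℕ → ℂ) (σ τ : Fin k → Fin 2) :
    (∑ j ∈ Finset.range (k + 1), c j * vkj k j σ * conj (vkj k j τ)) =
      if cnt σ = cnt τ then c (cnt σ) * (k.choose (cnt σ) : ℂ)⁻¹ else 0 := by
  rw [Finset.sum_eq_single_of_mem (cnt σ) (Finset.mem_range_succ_iff.mpr (cnt_le σ))]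
  · rw [← ofReal_inv_sqrt_mul_conj]
    by_cases h : cnt σ = cnt τ
    · simp [vkj, h, mul_assoc]
    · simp [vkj, h, Ne.symm h]
  · intro j _ hj
    simp [vkj, hj.symm]

/-- the `k`-body reduced density matrix of the fragmented state
`φ₁^{⊗N₁} ∨ φ₂^{⊗N₂}` equals `Σ_{j=0}^{k} c_{k,j} |v_{k,j}⟩⟨v_{k,j}|` with
`c_{k,j} = binom(N₁,k−j)·binom(N₂,j)/binom(N,k)`. -/
theorem stmt5 (N N₁ N₂ k : ℕ) (hN : N₁ + N₂ = N) (hN2 : 2 ≤ N)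
    (hk1 : 1 ≤ k) (hkN : k ≤ N - 1) (σ τ : Fin k → Fin 2) :
    (∑ ρ : Fin (N - k) → Fin 2,
        Psi N N₁ N₂ (concat (by omega) σ ρ) * conj (Psi N N₁ N₂ (concat (by omega) τ ρ)))
      = ∑ j ∈ Finset.range (k + 1),
          ((((N₁.choose (k - j) : ℝ) * (N₂.choose j : ℝ) / (N.choose k : ℝ)) : ℝ) : ℂ)
            * vkj k j σ * conj (vkj k j τ) := by
  subst hN
  have hk : k ≤ N₁ + N₂ := by omega
  rw [sum_Psi_mul_conj_eq hk, sum_mul_vkj_mul_conj_eq]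
  by_cases hστ : cnt σ = cnt τ
  swap
  · simp [hστ]
  rw [if_pos hστ]
  by_cases hj : cnt σ ≤ N₂
  · rw [if_pos ⟨hστ, hj⟩]
    have h₁ : ((N₁ + N₂).choose N₁ : ℂ) ≠ 0 := by
      exact_mod_cast (Nat.choose_pos (Nat.le_add_right N₁ N₂)).ne'
    have h₂ : ((N₁ + N₂).choose k : ℂ) ≠ 0 := by exact_mod_cast (Nat.choose_pos hk).ne'
    have h₃ : (k.choose (cnt σ) : ℂ) ≠ 0 := by exact_mod_cast (Nat.choose_pos (cnt_le σ)).ne'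
    have h := congrArg (Nat.cast : ℕ → ℂ)
      (choose_sub_mul_choose_mul_choose (N₁ := N₁) (cnt_le σ) hj)
    push_cast at h ⊢
    field_simp
    linear_combination h
  · rw [if_neg (fun h => hj h.2), Nat.choose_eq_zero_of_lt (not_le.mp hj)]
    simp

end
end

section
/- Let ℓ, N, k ∈ ℕ with ℓ ≥ 2, N ≥ 2, 1 ≤ k ≤ N−1, and let N₁,…,N_ℓ ∈ ℕ with N₁ + ⋯ + N_ℓ = N. Let Ψ_N : (Fin N → Fin ℓ) → ℂ be defined by Ψ_N(σ) = (N!/(N₁!⋯N_ℓ!) : ℝ)^{−1/2} if cnt_p(σ) = N_p for every p ∈ {1,…,ℓ}, and Ψ_N(σ) = 0 otherwise. For a tuple a = (a₁,…,a_ℓ) of natural numbers with a₁+⋯+a_ℓ = k, let v_a : (Fin k → Fin ℓ) → ℂ be defined by v_a(σ) = (k!/(a₁!⋯a_ℓ!) : ℝ)^{−1/2} if cnt_p(σ) = a_p for every p, and v_a(σ) = 0 otherwise. Then the matrix γ^{(k)} indexed by (Fin k → Fin ℓ) with entries γ^{(k)}(σ,τ) = Σ_{ρ : Fin (N−k) →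 Fin ℓ} Ψ_N(σ⌢ρ)·conj(Ψ_N(τ⌢ρ)) satisfies γ^{(k)}(σ,τ) = Σ_{a : a₁+⋯+a_ℓ=k} c_a · v_a(σ) · conj(v_a(τ)), where c_a = binom(N,k)⁻¹ · ∏_{p=1}^{ℓ} binom(N_p, a_p). -/
open scoped BigOperators
open ComplexConjugate

noncomputable section

/-- Number of indices `i` with `σ i = p`. -/
def cntP {ℓ m : ℕ} (p : Fin ℓ) (σ : Fin m → Fin ℓ) : ℕ :=
  (Finset.univ.filter fun i => σ i = p).card

/-- Coordinate vector of the ℓ-level fragmented state `φ₁^{⊗N₁} ∨ ⋯ ∨ φ_ℓ^{⊗N_ℓ}`,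
with normalisation `(N!/(N₁!⋯N_ℓ!))^{−1/2}`. -/
def PsiL (ℓ N : ℕ) (Npop : Fin ℓ → ℕ) (σ : Fin N → Fin ℓ) : ℂ :=
  if ∀ p, cntP p σ = Npop p then
    (((Real.sqrt ((N.factorial : ℝ) / ∏ p, ((Npop p).factorial : ℝ)))⁻¹ : ℝ) : ℂ)
  else 0

/-- Coordinate vector of the normalized symmetric tensor `φ₁^{⊗a₁} ∨ ⋯ ∨ φ_ℓ^{⊗a_ℓ}`,
with normalisation `(k!/(a₁!⋯a_ℓ!))^{−1/2}`. -/
def va (ℓ k : ℕ) (a : Fin ℓ → ℕ) (σ : Fin k → Fin ℓ) : ℂ :=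
  if ∀ p, cntP p σ = a p then
    (((Real.sqrt ((k.factorial : ℝ) / ∏ p, ((a p).factorial : ℝ)))⁻¹ : ℝ) : ℂ)
  else 0

/-- The occupation numbers of an `m`-particle configuration add up to `m`. -/
theorem sum_cntP {ℓ m : ℕ} (σ : Fin m → Fin ℓ) : ∑ p, cntP p σ = m := by
  have h := Finset.card_eq_sum_card_fiberwise (s := Finset.univ) (t := Finset.univ) (f := σ)
    (fun _ _ => Finset.mem_coe.2 (Finset.mem_univ _))
  simpa [cntP] using h.symm

theorem cntP_cons {ℓ m : ℕ} (p q : Fin ℓ) (ρ : Fin m → Fin ℓ) :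
    cntP p (Fin.cons q ρ : Fin (m + 1) → Fin ℓ) = (if q = p then 1 else 0) + cntP p ρ := by
  simp only [cntP, Finset.card_filter, Fin.sum_univ_succ, Fin.cons_zero, Fin.cons_succ]

theorem cntP_concat {ℓ N k : ℕ} (h : k ≤ N) (p : Fin ℓ) (σ : Fin k → Fin ℓ)
    (ρ : Fin (N - k) → Fin ℓ) : cntP p (concat h σ ρ) = cntP p σ + cntP p ρ := by
  obtain ⟨n, rfl⟩ := Nat.exists_eq_add_of_le h
  have e : k + n = k + (k + n - k) := by omega
  simp only [cntP, Finset.card_filter]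
  rw [← Equiv.sum_comp (finCongr e.symm), Fin.sum_univ_add]
  simp [concat]

/-- The number of configurations with occupation numbers `b` is the multinomial coefficient. -/
theorem card_cntP_eq_mul_prod_factorial {ℓ m : ℕ} (b : Fin ℓ → ℕ) (hb : ∑ p, b p = m) :
    (Finset.univ.filter fun ρ : Fin m → Fin ℓ => ∀ p, cntP p ρ = b p).card
      * ∏ p, (b p).factorial = m.factorial := by
  induction m generalizing b with
  | zero =>
    have hb0 : ∀ p, b p = 0 := by simpa using hb
    simp [hb0, cntP]
  | succ m ih =>
    have key : ∀ q : Fin ℓ,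
        (∑ ρ : Fin m → Fin ℓ,
          if ∀ p, cntP p (Fin.cons q ρ : Fin (m + 1) → Fin ℓ) = b p then 1 else 0)
          * ∏ p, (b p).factorial = b q * m.factorial := by
      intro q
      rcases Nat.eq_zero_or_pos (b q) with h0 | hpos
      · rw [Finset.sum_eq_zero, h0]
        · simp
        · intro ρ _
          refine if_neg fun h => ?_
          have := h q
          rw [cntP_cons, if_pos rfl, h0] at this
          omega
      · have hq : ∀ p ∈ Finset.univ.erase q,
            Function.update b q (b q - 1) p = b p := fun p hp =>
          Function.update_of_ne (Finset.ne_of_mem_erase hp) _ _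
        have hsum : ∑ p, Function.update b q (b q - 1) p = m := by
          have hbq : b q + ∑ p ∈ Finset.univ.erase q, b p = ∑ p, b p :=
            Finset.add_sum_erase Finset.univ b (Finset.mem_univ q)
          rw [← Finset.add_sum_erase _ _ (Finset.mem_univ q), Finset.sum_congr rfl hq,
            Function.update_self]
          change b q - 1 + ∑ p ∈ Finset.univ.erase q, b p = m
          omega
        have hfact : ∏ p, (b p).factorial
            = b q * ∏ p, (Function.update b q (b q - 1) p).factorial := by
          rw [← Finset.mul_prod_erase _ _ (Finset.mem_univ q),
            ← Finset.mul_prod_erase _ (fun p => (Function.update b q (b q - 1) p).factorial)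
              (Finset.mem_univ q),
            Finset.prod_congr rfl fun p hp => congrArg Nat.factorial (hq p hp),
            Function.update_self, ← mul_assoc, Nat.mul_factorial_pred hpos.ne']
        have hiff : ∀ ρ : Fin m → Fin ℓ,
            (∀ p, cntP p (Fin.cons q ρ : Fin (m + 1) → Fin ℓ) = b p) ↔
              ∀ p, cntP p ρ = Function.update b q (b q - 1) p := by
          refine fun ρ => forall_congr' fun p => ?_
          rw [cntP_cons]
          by_cases hp : q = p
          · subst hp
            rw [if_pos rfl, Function.update_self]
            omega
          · rw [if_neg hp, Function.update_of_ne (Ne.symm hp), zero_add]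
        simp only [hiff]
        rw [← Finset.card_filter, hfact, ← ih _ hsum]
        ring
    rw [Finset.card_filter, ← Equiv.sum_comp (Fin.consEquiv fun _ => Fin ℓ),
      Fintype.sum_prod_type, Finset.sum_mul]
    refine (Finset.sum_congr rfl fun q _ => key q).trans ?_
    rw [← Finset.sum_mul, hb, Nat.factorial_succ]

/-- The number of ways to complete `s` to the occupation numbers `b`. -/
theorem card_add_cntP_eq_mul_prod_factorial {ℓ k n : ℕ} (s b : Fin ℓ → ℕ)
    (hs : ∑ p, s p = k) (hb : ∑ p, b p = k + n) :
    (Finset.univ.filter fun ρ : Fin n → Fin ℓ => ∀ p, s p + cntP p ρ = b p).card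
      * ∏ p, (b p).factorial
      = n.factorial * ((∏ p, (b p).choose (s p)) * ∏ p, (s p).factorial) := by
  by_cases h : ∀ p, s p ≤ b p
  · have hiff : ∀ ρ : Fin n → Fin ℓ,
        (∀ p, s p + cntP p ρ = b p) ↔ ∀ p, cntP p ρ = b p - s p := fun ρ =>
      forall_congr' fun p => by have := h p; omega
    have hsum : ∑ p, (b p - s p) = n := by
      rw [Finset.sum_tsub_distrib _ fun p _ => h p]
      omega
    rw [← card_cntP_eq_mul_prod_factorial _ hsum,
      ← Finset.prod_congr rfl fun p _ => Nat.choose_mul_factorial_mul_factorial (h p)]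
    simp only [hiff, Finset.prod_mul_distrib]
    ring
  · push Not at h
    obtain ⟨p, hp⟩ := h
    rw [Finset.prod_eq_zero (f := fun p => (b p).choose (s p)) (Finset.mem_univ p)
        (Nat.choose_eq_zero_of_lt hp), Finset.card_eq_zero.2]
    · simp
    · refine Finset.filter_eq_empty_iff.2 fun ρ _ h => ?_
      have := h p
      omega

theorem va_mul_conj {ℓ k : ℕ} (a : Fin ℓ → ℕ) (σ τ : Fin k → Fin ℓ) :
    va ℓ k a σ * conj (va ℓ k a τ)
      = if (∀ p, cntP p σ = a p) ∧ ∀ p, cntP p τ = a p then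
          (∏ p, ((a p).factorial : ℂ)) / (k.factorial : ℂ) else 0 := by
  unfold va
  by_cases h₁ : ∀ p, cntP p σ = a p
  · by_cases h₂ : ∀ p, cntP p τ = a p
    · rw [if_pos h₁, if_pos h₂, if_pos ⟨h₁, h₂⟩, Complex.conj_ofReal, ← Complex.ofReal_mul,
        ← mul_inv, Real.mul_self_sqrt (by positivity), inv_div]
      push_cast
      rfl
    · rw [if_neg h₂, if_neg (mt And.right h₂), map_zero, mul_zero]
  · rw [if_neg h₁, if_neg (mt And.left h₁), zero_mul]

/-- the `k`-body reduced density matrix of the ℓ-level fragmented state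
equals `Σ_{a₁+⋯+a_ℓ=k} c_a |v_a⟩⟨v_a|` with `c_a = binom(N,k)⁻¹ ∏_p binom(N_p, a_p)`. -/
theorem stmt6 (ℓ N k : ℕ) (hℓ : 2 ≤ ℓ) (hN2 : 2 ≤ N) (hk1 : 1 ≤ k) (hkN : k ≤ N - 1)
    (Npop : Fin ℓ → ℕ) (hsum : (∑ p, Npop p) = N) (σ τ : Fin k → Fin ℓ) :
    (∑ ρ : Fin (N - k) → Fin ℓ,
        PsiL ℓ N Npop (concat (by omega) σ ρ) * conj (PsiL ℓ N Npop (concat (by omega) τ ρ)))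
      = ∑ a ∈ Finset.Nat.antidiagonalTuple ℓ k,
          ((((N.choose k : ℝ))⁻¹ * ∏ p, ((Npop p).choose (a p) : ℝ) : ℝ) : ℂ)
            * va ℓ k a σ * conj (va ℓ k a τ) := by
  have hk : k ≤ N := by omega
  change (∑ ρ : Fin (N - k) → Fin ℓ,
    va ℓ N Npop (concat hk σ ρ) * conj (va ℓ N Npop (concat hk τ ρ))) = _
  simp only [mul_assoc, va_mul_conj, cntP_concat]
  by_cases hστ : ∀ p, cntP p τ = cntP p σ
  · simp only [hστ, and_self]
    rw [Finset.sum_eq_single (fun p => cntP p σ)]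
    · rw [if_pos fun _ => rfl, ← Finset.sum_filter, Finset.sum_const, nsmul_eq_mul]
      have hcard := card_add_cntP_eq_mul_prod_factorial (n := N - k) (fun p => cntP p σ) Npop
        (sum_cntP σ) (by omega)
      have hchoose := Nat.choose_mul_factorial_mul_factorial hk
      have hC : (N.choose k : ℂ) ≠ 0 := Nat.cast_ne_zero.2 (Nat.choose_pos hk).ne'
      have hN : (N.factorial : ℂ) ≠ 0 := Nat.cast_ne_zero.2 N.factorial_ne_zero
      have hkf : (k.factorial : ℂ) ≠ 0 := Nat.cast_ne_zero.2 k.factorial_ne_zero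
      have hcard' := congrArg (Nat.cast : ℕ → ℂ) hcard
      have hchoose' := congrArg (Nat.cast : ℕ → ℂ) hchoose
      push_cast at hcard' hchoose' ⊢
      rw [← mul_div_assoc, hcard', ← hchoose']
      have hNk : ((N - k).factorial : ℂ) ≠ 0 := Nat.cast_ne_zero.2 (N - k).factorial_ne_zero
      field_simp
    · intro a _ ha
      rw [if_neg fun h => ha (funext fun p => (h p).symm), mul_zero]
    · intro h
      exact absurd (Finset.Nat.mem_antidiagonalTuple.2 (sum_cntP σ)) h
  · rw [Finset.sum_eq_zero, Finset.sum_eq_zero]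
    · intro a _
      rw [if_neg fun h => hστ fun p => (h.2 p).trans (h.1 p).symm, mul_zero]
    · intro ρ _
      exact if_neg fun h => hστ fun p =>
        Nat.add_right_cancel ((h.2 p).trans (h.1 p).symm)

end
end

section
/- Let κ ∈ (0,1) and fix k ∈ ℕ with k ≥ 1. There exists a constant c_k > 0, depending only on k and κ, with the following property. For every N ∈ ℕ with N ≥ 2 and every N₁, N₂ ∈ ℕ with N₁ + N₂ = N, κ·N ≤ N₁ < N and κ·N ≤ N₂ < N, the Hermitian matrix D indexed by (Fin k → Fin 2) defined by D(σ,τ) = Σ_{j=0}^{k} ( c_{k,j} − c̃_{k,j} ) · v_{k,j}(σ) · conj(v_{k,j}(τ)), where c_{k,j} = binom(N₁,k−j)·binom(N₂,j)/binom(N,k) and c̃_{k,j} = binom(k,j)·N₁^{k−j}·N₂^{j}/N^{k}, satisfies: the sum of the absolute values of the eigenvalues of D is at most c_k / N. -/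
open scoped BigOperators
open ComplexConjugate

noncomputable section

/-- The difference matrix `D = γ_N^{(k)} − γ̃_N^{(k)}`, with hypergeometric coefficients
`c_{k,j} = binom(N₁,k−j)binom(N₂,j)/binom(N,k)` and binomial coefficients
`c̃_{k,j} = binom(k,j)N₁^{k−j}N₂^{j}/N^{k}`. -/
def Dmat (k N N₁ N₂ : ℕ) : Matrix (Fin k → Fin 2) (Fin k → Fin 2) ℂ :=
  Matrix.of fun σ τ =>
    ∑ j ∈ Finset.range (k + 1),
      (((((N₁.choose (k - j) : ℝ) * (N₂.choose j : ℝ)) / (N.choose k : ℝ)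
          - (k.choose j : ℝ) * (N₁ : ℝ) ^ (k - j) * (N₂ : ℝ) ^ j / (N : ℝ) ^ k : ℝ)) : ℂ)
        * vkj k j σ * conj (vkj k j τ)

/-- The falling factorial of `n ≤ N` differs from the power by at most `a² N^(a-1)`. -/
theorem mul_pow_sub_descFactorial_le {n N : ℕ} (h : n ≤ N) (a : ℕ) :
    (N : ℝ) * ((n : ℝ) ^ a - n.descFactorial a) ≤ (a : ℝ) ^ 2 * (N : ℝ) ^ a := by
  induction a with
  | zero => simp
  | succ a ih =>
    have hn : (n : ℝ) ≤ N := by exact_mod_cast h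
    have hn0 : (0 : ℝ) ≤ n := n.cast_nonneg
    have hN0 : (0 : ℝ) ≤ N := N.cast_nonneg
    have hd0 : (0 : ℝ) ≤ n.descFactorial a := Nat.cast_nonneg _
    have hd : (n.descFactorial a : ℝ) ≤ (N : ℝ) ^ a := by
      calc (n.descFactorial a : ℝ) ≤ (n : ℝ) ^ a := by exact_mod_cast Nat.descFactorial_le_pow n a
        _ ≤ (N : ℝ) ^ a := by gcongr
    have hsub : (n : ℝ) - a ≤ ((n - a : ℕ) : ℝ) := by
      rw [sub_le_iff_le_add]
      exact_mod_cast (by omega : n ≤ n - a + a)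
    have hstep : ((n : ℝ) - a) * n.descFactorial a ≤ n.descFactorial (a + 1) := by
      rw [Nat.descFactorial_succ, Nat.cast_mul]
      gcongr
    calc (N : ℝ) * ((n : ℝ) ^ (a + 1) - n.descFactorial (a + 1))
        ≤ N * ((n : ℝ) ^ (a + 1) - ((n : ℝ) - a) * n.descFactorial a) := by gcongr
      _ = n * (N * ((n : ℝ) ^ a - n.descFactorial a)) + a * N * n.descFactorial a := by ring
      _ ≤ N * ((a : ℝ) ^ 2 * (N : ℝ) ^ a) + a * N * (N : ℝ) ^ a := by
          refine add_le_add ?_ (by gcongr)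
          exact (mul_le_mul_of_nonneg_left ih hn0).trans
            (mul_le_mul_of_nonneg_right hn (by positivity))
      _ = ((a : ℝ) ^ 2 + a) * (N : ℝ) ^ (a + 1) := by ring
      _ ≤ ((a + 1 : ℕ) : ℝ) ^ 2 * (N : ℝ) ^ (a + 1) := by
          gcongr
          push_cast
          nlinarith [(a.cast_nonneg : (0 : ℝ) ≤ a)]

/-- The products of falling factorials and of powers agree to leading order. -/
theorem mul_pow_mul_pow_sub_descFactorial_le {m n N : ℕ} (hm : m ≤ N) (hn : n ≤ N) (a b : ℕ) :
    (N : ℝ) * ((m : ℝ) ^ a * (n : ℝ) ^ b - m.descFactorial a * n.descFactorial b) ≤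
      ((a : ℝ) ^ 2 + (b : ℝ) ^ 2) * (N : ℝ) ^ (a + b) := by
  have hma : (m : ℝ) ^ a ≤ (N : ℝ) ^ a := by gcongr
  have hnb : (n.descFactorial b : ℝ) ≤ (N : ℝ) ^ b := by
    exact_mod_cast (Nat.descFactorial_le_pow n b).trans (Nat.pow_le_pow_left hn b)
  calc (N : ℝ) * ((m : ℝ) ^ a * (n : ℝ) ^ b - m.descFactorial a * n.descFactorial b)
      = (m : ℝ) ^ a * (N * ((n : ℝ) ^ b - n.descFactorial b)) +
          N * ((m : ℝ) ^ a - m.descFactorial a) * n.descFactorial b := by ring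
    _ ≤ (N : ℝ) ^ a * ((b : ℝ) ^ 2 * (N : ℝ) ^ b) + (a : ℝ) ^ 2 * (N : ℝ) ^ a * (N : ℝ) ^ b := by
        apply add_le_add
        · exact (mul_le_mul_of_nonneg_left (mul_pow_sub_descFactorial_le hn b)
            (by positivity)).trans (mul_le_mul_of_nonneg_right hma (by positivity))
        · exact (mul_le_mul_of_nonneg_right (mul_pow_sub_descFactorial_le hm a)
            (by positivity)).trans (mul_le_mul_of_nonneg_left hnb (by positivity))
    _ = _ := by ring

/-- Hypergeometric and binomial weights differ by `O(1/N)`. -/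
theorem abs_hypergeometric_sub_binomial_le {m n a b : ℕ} (hN : 0 < m + n) :
    |(m.choose a : ℝ) * n.choose b / (m + n).choose (a + b) -
        (a + b).choose b * (m : ℝ) ^ a * (n : ℝ) ^ b / ((m + n : ℕ) : ℝ) ^ (a + b)| ≤
      ((a + b : ℕ) : ℝ) ^ 2 * (1 + 2 ^ (a + b)) / (m + n : ℕ) := by
  set N := m + n with hNdef
  set k := a + b with hk
  have hN' : (0 : ℝ) < N := by exact_mod_cast hN
  have hle : (m.choose a : ℝ) * n.choose b ≤ N.choose k := by
    have := Finset.single_le_sum (f := fun ij : ℕ × ℕ => m.choose ij.1 * n.choose ij.2)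
      (fun _ _ => Nat.zero_le _)
      (Finset.HasAntidiagonal.mem_antidiagonal (a := (a, b)) |>.2 hk.symm)
    rw [← Nat.add_choose_eq] at this
    exact_mod_cast this
  set c : ℝ := (m.choose a : ℝ) * n.choose b / N.choose k with hc
  have hc0 : 0 ≤ c := by positivity
  have hc1 : c ≤ 1 := div_le_one_of_le₀ hle (by positivity)
  have hcd : c * N.choose k = m.choose a * n.choose b := by
    rcases eq_or_ne (N.choose k : ℝ) 0 with h | h
    · rw [h] at hle ⊢
      rw [mul_zero]
      exact le_antisymm (by positivity) hle
    · exact div_mul_cancel₀ _ h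
  have hfac : ((k.choose b : ℝ)) * (m.descFactorial a * n.descFactorial b) =
      c * N.descFactorial k := by
    have h : (k.choose b : ℝ) * b.factorial * a.factorial = k.factorial := by
      have := Nat.choose_mul_factorial_mul_factorial (show b ≤ k by omega)
      rw [show k - b = a by omega] at this
      exact_mod_cast this
    simp only [Nat.descFactorial_eq_factorial_mul_choose, Nat.cast_mul]
    linear_combination (m.choose a * n.choose b : ℝ) * h - (k.factorial : ℝ) * hcd
  have h₁ := mul_pow_sub_descFactorial_le (le_refl N) k
  have h₁' : (N.descFactorial k : ℝ) ≤ (N : ℝ) ^ k := by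
    exact_mod_cast Nat.descFactorial_le_pow N k
  have h₂ := mul_pow_mul_pow_sub_descFactorial_le (show m ≤ N by omega) (show n ≤ N by omega) a b
  have h₂' : (m.descFactorial a * n.descFactorial b : ℝ) ≤ (m : ℝ) ^ a * (n : ℝ) ^ b := by
    exact_mod_cast Nat.mul_le_mul (Nat.descFactorial_le_pow m a) (Nat.descFactorial_le_pow n b)
  have hch : (k.choose b : ℝ) ≤ 2 ^ k := by exact_mod_cast Nat.choose_le_two_pow k b
  have hab : (a : ℝ) ^ 2 + (b : ℝ) ^ 2 ≤ (k : ℝ) ^ 2 := by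
    rw [hk]
    push_cast
    nlinarith [mul_nonneg (a.cast_nonneg : (0 : ℝ) ≤ a) (b.cast_nonneg : (0 : ℝ) ≤ b)]
  have hA : c * (N * ((N : ℝ) ^ k - N.descFactorial k)) ≤ (k : ℝ) ^ 2 * (N : ℝ) ^ k :=
    (mul_le_of_le_one_left (mul_nonneg hN'.le (sub_nonneg.2 h₁')) hc1).trans h₁
  have hA0 : 0 ≤ c * (N * ((N : ℝ) ^ k - N.descFactorial k)) :=
    mul_nonneg hc0 (mul_nonneg hN'.le (sub_nonneg.2 h₁'))
  have hB0 : 0 ≤ (k.choose b : ℝ) *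
      (N * ((m : ℝ) ^ a * (n : ℝ) ^ b - m.descFactorial a * n.descFactorial b)) :=
    mul_nonneg (by positivity) (mul_nonneg hN'.le (sub_nonneg.2 h₂'))
  have hB : (k.choose b : ℝ) *
      (N * ((m : ℝ) ^ a * (n : ℝ) ^ b - m.descFactorial a * n.descFactorial b)) ≤
      2 ^ k * ((k : ℝ) ^ 2 * (N : ℝ) ^ k) :=
    mul_le_mul hch (h₂.trans (mul_le_mul_of_nonneg_right hab (by positivity)))
      (mul_nonneg hN'.le (sub_nonneg.2 h₂')) (by positivity)
  have key : c - k.choose b * (m : ℝ) ^ a * (n : ℝ) ^ b / (N : ℝ) ^ k =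
      (c * (N * ((N : ℝ) ^ k - N.descFactorial k)) - (k.choose b : ℝ) *
        (N * ((m : ℝ) ^ a * (n : ℝ) ^ b - m.descFactorial a * n.descFactorial b))) /
        (N * (N : ℝ) ^ k) := by
    field_simp
    linear_combination -hfac
  rw [key, abs_div, abs_of_pos (by positivity : (0 : ℝ) < N * (N : ℝ) ^ k),
    div_le_div_iff₀ (by positivity) hN']
  have : |c * (N * ((N : ℝ) ^ k - N.descFactorial k)) - (k.choose b : ℝ) *
        (N * ((m : ℝ) ^ a * (n : ℝ) ^ b - m.descFactorial a * n.descFactorial b))| ≤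
      (k : ℝ) ^ 2 * (1 + 2 ^ k) * (N : ℝ) ^ k := by
    rw [abs_le]
    constructor <;> nlinarith [show (0 : ℝ) ≤ (k : ℝ) ^ 2 * (N : ℝ) ^ k by positivity,
      show (0 : ℝ) ≤ 2 ^ k * ((k : ℝ) ^ 2 * (N : ℝ) ^ k) by positivity]
  calc _ ≤ (k : ℝ) ^ 2 * (1 + 2 ^ k) * (N : ℝ) ^ k * N := by gcongr
    _ = _ := by ring

theorem norm_vkj_le_one (k j : ℕ) (σ : Fin k → Fin 2) : ‖vkj k j σ‖ ≤ 1 := by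
  unfold vkj
  split_ifs with h
  · have hj : j ≤ k := by
      rw [← h]
      exact (Finset.card_le_univ _).trans (by simp)
    have h1 : (1 : ℝ) ≤ k.choose j := by exact_mod_cast Nat.choose_pos hj
    rw [Complex.norm_real, Real.norm_of_nonneg (by positivity)]
    exact inv_le_one_of_one_le₀ (Real.one_le_sqrt.2 h1)
  · simp

theorem Dmat_isHermitian (k N N₁ N₂ : ℕ) : (Dmat k N N₁ N₂).IsHermitian := by
  ext σ τ
  simp only [Dmat, Matrix.conjTranspose_apply, Matrix.of_apply, star_sum, star_mul']
  refine Finset.sum_congr rfl fun j _ => ?_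
  simp only [← starRingEnd_apply, Complex.conj_ofReal, Complex.conj_conj]
  ring

theorem norm_Dmat_apply_le {k N₁ N₂ : ℕ} (hN : 0 < N₁ + N₂) (σ τ : Fin k → Fin 2) :
    ‖Dmat k (N₁ + N₂) N₁ N₂ σ τ‖ ≤
      (k + 1) * ((k : ℝ) ^ 2 * (1 + 2 ^ k) / (N₁ + N₂ : ℕ)) := by
  rw [Dmat, Matrix.of_apply]
  refine (norm_sum_le_of_le (Finset.range (k + 1))
    (f := _) (n := fun _ => (k : ℝ) ^ 2 * (1 + 2 ^ k) / (N₁ + N₂ : ℕ)) fun j hj => ?_).trans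
    (by simp)
  have hjk : k - j + j = k := by
    have := Finset.mem_range.1 hj
    omega
  have h := abs_hypergeometric_sub_binomial_le (a := k - j) (b := j) hN
  rw [hjk] at h
  rw [norm_mul, norm_mul, RCLike.norm_conj, Complex.norm_real, Real.norm_eq_abs]
  refine (mul_le_of_le_one_right (by positivity) (norm_vkj_le_one k j τ)).trans ?_
  exact (mul_le_of_le_one_right (abs_nonneg _) (norm_vkj_le_one k j σ)).trans h

/-- An eigenvalue of a Hermitian matrix with entries bounded by `B` is at most `B` times
the dimension. -/
theorem Matrix.IsHermitian.abs_eigenvalues_le {ι : Type*} [Fintype ι] [DecidableEq ι]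
    {A : Matrix ι ι ℂ} (hA : A.IsHermitian) {B : ℝ} (hB : ∀ i j, ‖A i j‖ ≤ B) (i : ι) :
    |hA.eigenvalues i| ≤ Fintype.card ι * B := by
  have hv : Module.End.HasEigenvalue (Matrix.toLin' A) (hA.eigenvalues i : ℂ) := by
    refine Module.End.hasEigenvalue_of_hasEigenvector
      (x := (hA.eigenvectorBasis i).ofLp) ⟨?_, ?_⟩
    · rw [Module.End.mem_eigenspace_iff, Matrix.toLin'_apply, hA.mulVec_eigenvectorBasis]
      rfl
    · intro h
      exact hA.eigenvectorBasis.toBasis.ne_zero i (by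
        rw [OrthonormalBasis.coe_toBasis]
        exact WithLp.ofLp_injective 2 h)
  obtain ⟨j, hj⟩ := eigenvalue_mem_ball hv
  rw [mem_closedBall_iff_norm] at hj
  calc |hA.eigenvalues i| = ‖(hA.eigenvalues i : ℂ)‖ := by simp
    _ ≤ ‖A j j‖ + ‖(hA.eigenvalues i : ℂ) - A j j‖ := norm_le_norm_add_norm_sub' _ _
    _ ≤ ‖A j j‖ + ∑ l ∈ Finset.univ.erase j, ‖A j l‖ := by gcongr
    _ = ∑ l, ‖A j l‖ := Finset.add_sum_erase _ (fun l => ‖A j l‖) (Finset.mem_univ j)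
    _ ≤ ∑ _l : ι, B := Finset.sum_le_sum fun l _ => hB j l
    _ = Fintype.card ι * B := by simp

/-- for `κ ∈ (0,1)` and fixed `k ≥ 1` there is `c_k > 0` such that for all
admissible `N, N₁, N₂` the Hermitian matrix `D` has trace norm (sum of absolute values
of its eigenvalues) at most `c_k / N`. -/
theorem stmt8 (κ : ℝ) (hκ : κ ∈ Set.Ioo (0 : ℝ) 1) (k : ℕ) (hk : 1 ≤ k) :
    ∃ c : ℝ, 0 < c ∧
      ∀ N N₁ N₂ : ℕ, 2 ≤ N → N₁ + N₂ = N →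
        κ * N ≤ (N₁ : ℝ) → N₁ < N → κ * N ≤ (N₂ : ℝ) → N₂ < N →
        ∃ hD : (Dmat k N N₁ N₂).IsHermitian,
          (∑ i : Fin k → Fin 2, |hD.eigenvalues i|) ≤ c / N := by
  have hk' : (0 : ℝ) < k := by exact_mod_cast hk
  refine ⟨2 ^ k * (2 ^ k * ((k + 1) * ((k : ℝ) ^ 2 * (1 + 2 ^ k)))), by positivity, ?_⟩
  rintro N N₁ N₂ hN rfl - - - -
  refine ⟨Dmat_isHermitian k _ N₁ N₂, ?_⟩
  refine (Finset.sum_le_sum fun i _ => (Dmat_isHermitian k _ N₁ N₂).abs_eigenvalues_le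
    (norm_Dmat_apply_le (by omega)) i).trans (le_of_eq ?_)
  simp only [Finset.sum_const, Finset.card_univ, Fintype.card_fun, Fintype.card_fin, nsmul_eq_mul,
    Nat.cast_pow, Nat.cast_ofNat]
  ring

end
end

section
/- Let ℓ ∈ ℕ with ℓ ≥ 2, let κ ∈ (0,1), and fix k ∈ ℕ with k ≥ 1. There exists a constant c_k > 0, depending only on k, ℓ and κ, such that for every N ∈ ℕ with N ≥ 2 and every N₁,…,N_ℓ ∈ ℕ with N₁+⋯+N_ℓ = N and κ·N ≤ N_p < N for each p, one has Σ_{a : a₁+⋯+a_ℓ=k} | binom(N,k)⁻¹·∏_{p=1}^{ℓ} binom(N_p,a_p) − (k!/(a₁!⋯a_ℓ!))·∏_{p=1}^{ℓ} N_p^{a_p}/N^{k} | ≤ c_k / N, the sum running over all tuples a = (a₁,…,a_ℓ) of natural numbers with a₁+⋯+a_ℓ = k and the expression being evaluated in ℝ. -/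
open scoped BigOperators

/-- Products of numbers in `[-1, 1]` depend on the factors in a Lipschitz way. -/
theorem abs_prod_sub_prod_le_sum {ι : Type*} (s : Finset ι) (u v : ι → ℝ)
    (hu : ∀ i ∈ s, |u i| ≤ 1) (hv : ∀ i ∈ s, |v i| ≤ 1) :
    |∏ i ∈ s, u i - ∏ i ∈ s, v i| ≤ ∑ i ∈ s, |u i - v i| := by
  classical
  induction s using Finset.induction_on with
  | empty => simp
  | insert i s hi ih =>
    rw [Finset.prod_insert hi, Finset.prod_insert hi, Finset.sum_insert hi]
    have hs := ih (fun j hj => hu j (Finset.mem_insert_of_mem hj))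
      (fun j hj => hv j (Finset.mem_insert_of_mem hj))
    have hi_u := hu i (Finset.mem_insert_self i s)
    have hprod : |∏ j ∈ s, v j| ≤ 1 := by
      rw [Finset.abs_prod]
      exact Finset.prod_le_one (fun _ _ => abs_nonneg _)
        (fun j hj => hv j (Finset.mem_insert_of_mem hj))
    calc |u i * ∏ j ∈ s, u j - v i * ∏ j ∈ s, v j|
        = |(u i - v i) * ∏ j ∈ s, v j + u i * (∏ j ∈ s, u j - ∏ j ∈ s, v j)| := by
          congr 1; ring
      _ ≤ |u i - v i| * |∏ j ∈ s, v j| + |u i| * |∏ j ∈ s, u j - ∏ j ∈ s, v j| := by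
          rw [← abs_mul, ← abs_mul]; exact abs_add_le _ _
      _ ≤ |u i - v i| * 1 + 1 * ∑ j ∈ s, |u j - v j| := by gcongr
      _ = _ := by ring

theorem descFactorial_div_pow_le_one {m N : ℕ} (hN : 0 < N) (hm : m ≤ N) (a : ℕ) :
    (m.descFactorial a : ℝ) / (N : ℝ) ^ a ≤ 1 := by
  rw [div_le_one (by positivity)]
  exact_mod_cast (Nat.descFactorial_le_pow m a).trans (Nat.pow_le_pow_left hm a)

/-- Falling factorials and powers agree up to a relative error of order `1 / N`. -/
theorem abs_descFactorial_div_pow_sub_le {m N : ℕ} (hN : 0 < N) (hm : m ≤ N) (a : ℕ) :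
    |(m.descFactorial a : ℝ) / (N : ℝ) ^ a - ((m : ℝ) / N) ^ a| ≤ (a : ℝ) ^ 2 / N := by
  have hN' : (0 : ℝ) < N := by exact_mod_cast hN
  induction a with
  | zero => simp
  | succ a ih =>
    have hd1 := descFactorial_div_pow_le_one hN hm a
    have hd0 : 0 ≤ (m.descFactorial a : ℝ) / (N : ℝ) ^ a := by positivity
    have ht0 : 0 ≤ (m : ℝ) / N := by positivity
    have ht1 : (m : ℝ) / N ≤ 1 := by
      rw [div_le_one hN']; exact_mod_cast hm
    have hdiff : |((m - a : ℕ) : ℝ) / N - (m : ℝ) / N| ≤ a / N := by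
      rw [← sub_div, abs_div, abs_of_pos hN']
      gcongr
      have h1 : ((m - a : ℕ) : ℝ) ≤ m := by exact_mod_cast Nat.sub_le m a
      have h2 : (m : ℝ) ≤ ((m - a : ℕ) : ℝ) + a := by
        exact_mod_cast (by omega : m ≤ (m - a) + a)
      rw [abs_le]; constructor <;> linarith [Nat.cast_nonneg (α := ℝ) a]
    generalize hd : (m.descFactorial a : ℝ) / (N : ℝ) ^ a = d at *
    have hstep : (m.descFactorial (a + 1) : ℝ) / (N : ℝ) ^ (a + 1)
        = ((m - a : ℕ) : ℝ) / N * d := by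
      rw [← hd, Nat.descFactorial_succ, pow_succ']
      push_cast
      rw [mul_div_mul_comm]
    calc |(m.descFactorial (a + 1) : ℝ) / (N : ℝ) ^ (a + 1) - ((m : ℝ) / N) ^ (a + 1)|
        = |(((m - a : ℕ) : ℝ) / N - (m : ℝ) / N) * d
            + (m : ℝ) / N * (d - ((m : ℝ) / N) ^ a)| := by
          rw [hstep, pow_succ']; congr 1; ring
      _ ≤ |((m - a : ℕ) : ℝ) / N - (m : ℝ) / N| * d
            + (m : ℝ) / N * |d - ((m : ℝ) / N) ^ a| := by
          refine (abs_add_le _ _).trans_eq ?_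
          rw [abs_mul, abs_mul, abs_of_nonneg hd0, abs_of_nonneg ht0]
      _ ≤ a / N * 1 + 1 * ((a : ℝ) ^ 2 / N) := by gcongr
      _ = ((a : ℝ) + (a : ℝ) ^ 2) / N := by ring
      _ ≤ ((a + 1 : ℕ) : ℝ) ^ 2 / N := by
          push_cast
          gcongr
          nlinarith [Nat.cast_nonneg (α := ℝ) a]

theorem pow_le_pow_self_mul_descFactorial {k N : ℕ} (hk : 1 ≤ k) (hkN : k ≤ N) :
    N ^ k ≤ k ^ k * N.descFactorial k := by
  have h : N ≤ k * (N + 1 - k) := by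
    obtain ⟨d, rfl⟩ := Nat.exists_eq_add_of_le hkN
    rw [show k + d + 1 - k = d + 1 by omega]
    nlinarith
  calc N ^ k ≤ (k * (N + 1 - k)) ^ k := Nat.pow_le_pow_left h k
    _ = k ^ k * (N + 1 - k) ^ k := mul_pow _ _ _
    _ ≤ k ^ k * N.descFactorial k := by
      gcongr
      exact Nat.pow_sub_le_descFactorial N k

/-- The ratio of falling factorials is close to the corresponding ratio of powers. -/
theorem abs_prod_descFactorial_div_sub_le {ι : Type*} [Fintype ι] {k N : ℕ} (hk : 1 ≤ k)
    (hN : 0 < N) (m a : ι → ℕ) (hm : ∀ p, m p ≤ N) (ha : ∑ p, a p = k) :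
    |(∏ p, ((m p).descFactorial (a p) : ℝ)) / (N.descFactorial k : ℝ)
        - (∏ p, (m p : ℝ) ^ a p) / (N : ℝ) ^ k|
      ≤ ((k : ℝ) ^ k * (k : ℝ) ^ 2 + Fintype.card ι * (k : ℝ) ^ 2 + k) / N := by
  have hN' : (0 : ℝ) < N := by exact_mod_cast hN
  have hpow : (N : ℝ) ^ k = ∏ p, (N : ℝ) ^ a p := by
    rw [Finset.prod_pow_eq_pow_sum, ha]
  set U := ∏ p, ((m p).descFactorial (a p) : ℝ) / (N : ℝ) ^ a p with hU
  set V := ∏ p, ((m p : ℝ) / N) ^ a p with hV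
  have hVeq : (∏ p, (m p : ℝ) ^ a p) / (N : ℝ) ^ k = V := by
    rw [hV, hpow, ← Finset.prod_div_distrib]
    simp only [div_pow]
  have hu1 : ∀ p, ((m p).descFactorial (a p) : ℝ) / (N : ℝ) ^ a p ≤ 1 := fun p =>
    descFactorial_div_pow_le_one hN (hm p) (a p)
  have hv1 : ∀ p, ((m p : ℝ) / N) ^ a p ≤ 1 := fun p =>
    pow_le_one₀ (by positivity) (by rw [div_le_one hN']; exact_mod_cast hm p)
  have hU0 : 0 ≤ U := Finset.prod_nonneg fun p _ => by positivity
  have hU1 : U ≤ 1 := Finset.prod_le_one (fun p _ => by positivity) (fun p _ => hu1 p)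
  have hV0 : 0 ≤ V := Finset.prod_nonneg fun p _ => by positivity
  have hV1 : V ≤ 1 := Finset.prod_le_one (fun p _ => by positivity) (fun p _ => hv1 p)
  rw [hVeq]
  rcases lt_or_ge N k with hNk | hkN
  · rw [Nat.descFactorial_of_lt hNk]
    have hNk' : (N : ℝ) ≤ k := by exact_mod_cast hNk.le
    rw [Nat.cast_zero, div_zero, zero_sub, abs_neg, abs_of_nonneg hV0, le_div_iff₀ hN']
    have h1 : 0 ≤ (k : ℝ) ^ k * (k : ℝ) ^ 2 + Fintype.card ι * (k : ℝ) ^ 2 := by positivity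
    nlinarith
  · have hUV : |U - V| ≤ Fintype.card ι * (k : ℝ) ^ 2 / N := by
      refine (abs_prod_sub_prod_le_sum _ _ _ (fun p _ => ?_) (fun p _ => ?_)).trans ?_
      · rw [abs_of_nonneg (by positivity)]; exact hu1 p
      · rw [abs_of_nonneg (by positivity)]; exact hv1 p
      · calc _ ≤ ∑ _p : ι, (k : ℝ) ^ 2 / N := by
              refine Finset.sum_le_sum fun p _ =>
                (abs_descFactorial_div_pow_sub_le hN (hm p) (a p)).trans ?_
              have : a p ≤ k := ha ▸ Finset.single_le_sum (fun _ _ => Nat.zero_le _)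
                (Finset.mem_univ p)
              gcongr
          _ = _ := by simp [mul_div_assoc]
    have hD : (0 : ℝ) < N.descFactorial k := by
      exact_mod_cast Nat.descFactorial_pos.mpr hkN
    set w := (N.descFactorial k : ℝ) / (N : ℝ) ^ k with hw
    have hw0 : 0 < w := by positivity
    have hw1 : |1 - w| ≤ (k : ℝ) ^ 2 / N := by
      have := abs_descFactorial_div_pow_sub_le hN le_rfl k
      rwa [div_self hN'.ne', one_pow, abs_sub_comm] at this
    have hwk : 1 ≤ (k : ℝ) ^ k * w := by
      rw [hw, ← mul_div_assoc, one_le_div (by positivity)]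
      exact_mod_cast pow_le_pow_self_mul_descFactorial hk hkN
    have hx : (∏ p, ((m p).descFactorial (a p) : ℝ)) / (N.descFactorial k : ℝ) = U / w := by
      rw [hU, hw, Finset.prod_div_distrib, ← hpow]
      field_simp
    have hx0 : 0 ≤ U / w := by positivity
    have hxk : U / w ≤ (k : ℝ) ^ k := by
      rw [div_le_iff₀ hw0]; linarith
    rw [hx]
    calc |U / w - V| = |U / w * (1 - w) + (U - V)| := by
          congr 1; field_simp; ring
      _ ≤ U / w * |1 - w| + |U - V| := by
          refine (abs_add_le _ _).trans_eq ?_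
          rw [abs_mul, abs_of_nonneg hx0]
      _ ≤ (k : ℝ) ^ k * ((k : ℝ) ^ 2 / N) + Fintype.card ι * (k : ℝ) ^ 2 / N := by gcongr
      _ = ((k : ℝ) ^ k * (k : ℝ) ^ 2 + Fintype.card ι * (k : ℝ) ^ 2 + 0) / N := by ring
      _ ≤ _ := by gcongr; positivity

theorem cast_choose_eq_descFactorial_div (n a : ℕ) :
    (n.choose a : ℝ) = (n.descFactorial a : ℝ) / (a.factorial : ℝ) := by
  rw [Nat.descFactorial_eq_factorial_mul_choose, Nat.cast_mul,
    mul_div_cancel_left₀ _ (by exact_mod_cast a.factorial_ne_zero)]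

/-- ℓ¹ bound on the coefficient differences, summed over all tuples
`a = (a₁,…,a_ℓ)` with `a₁+⋯+a_ℓ = k`:
`Σ_a |binom(N,k)⁻¹ ∏ binom(N_p,a_p) − (k!/(a₁!⋯a_ℓ!)) ∏ N_p^{a_p} / N^k| ≤ c_k / N`. -/
theorem stmt9 (ℓ : ℕ) (hℓ : 2 ≤ ℓ) (κ : ℝ) (hκ : κ ∈ Set.Ioo (0 : ℝ) 1)
    (k : ℕ) (hk : 1 ≤ k) :
    ∃ c : ℝ, 0 < c ∧
      ∀ N : ℕ, 2 ≤ N → ∀ Npop : Fin ℓ → ℕ, (∑ p, Npop p) = N →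
        (∀ p : Fin ℓ, κ * N ≤ (Npop p : ℝ) ∧ Npop p < N) →
        (∑ a ∈ Finset.Nat.antidiagonalTuple ℓ k,
            |((N.choose k : ℝ))⁻¹ * (∏ p, ((Npop p).choose (a p) : ℝ))
              - ((k.factorial : ℝ) / ∏ p, ((a p).factorial : ℝ))
                  * (∏ p, (Npop p : ℝ) ^ (a p)) / (N : ℝ) ^ k|)
          ≤ c / N := by
  set K : ℝ := (k : ℝ) ^ k * (k : ℝ) ^ 2 + Fintype.card (Fin ℓ) * (k : ℝ) ^ 2 + k with hK
  have hk' : (0 : ℝ) < k := by exact_mod_cast hk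
  have hK0 : 0 < K := by positivity
  refine ⟨((Finset.Nat.antidiagonalTuple ℓ k).card + 1) * (k.factorial * K), by positivity, ?_⟩
  intro N hN Npop _ hpop
  have hN' : (0 : ℝ) < N := by exact_mod_cast (by omega : 0 < N)
  have hterm : ∀ a ∈ Finset.Nat.antidiagonalTuple ℓ k,
      |((N.choose k : ℝ))⁻¹ * (∏ p, ((Npop p).choose (a p) : ℝ))
        - ((k.factorial : ℝ) / ∏ p, ((a p).factorial : ℝ))
            * (∏ p, (Npop p : ℝ) ^ (a p)) / (N : ℝ) ^ k| ≤ k.factorial * K / N := by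
    intro a ha
    rw [Finset.Nat.mem_antidiagonalTuple] at ha
    have hfac : (1 : ℝ) ≤ ∏ p, ((a p).factorial : ℝ) := by
      exact_mod_cast Finset.one_le_prod' fun p _ => (a p).factorial_pos
    have hcoef : (k.factorial : ℝ) / ∏ p, ((a p).factorial : ℝ) ≤ k.factorial :=
      div_le_self (by positivity) hfac
    have hcoef0 : 0 ≤ (k.factorial : ℝ) / ∏ p, ((a p).factorial : ℝ) := by positivity
    have hbound := abs_prod_descFactorial_div_sub_le hk (by omega : 0 < N) Npop a
      (fun p => (hpop p).2.le) ha
    simp only [cast_choose_eq_descFactorial_div, Finset.prod_div_distrib, inv_div]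
    calc _ = |(k.factorial : ℝ) / (∏ p, ((a p).factorial : ℝ))
            * ((∏ p, ((Npop p).descFactorial (a p) : ℝ)) / (N.descFactorial k : ℝ)
              - (∏ p, (Npop p : ℝ) ^ a p) / (N : ℝ) ^ k)| := by
          congr 1; ring
      _ ≤ k.factorial * (K / N) := by
          rw [abs_mul, abs_of_nonneg hcoef0]
          gcongr
      _ = _ := by ring
  refine (Finset.sum_le_card_nsmul _ _ _ hterm).trans ?_
  rw [nsmul_eq_mul, ← mul_div_assoc]
  gcongr
  linarith
end

section
/- Let N, N₁, N₂, k ∈ ℕ with N = N₁ + N₂, 1 ≤ k ≤ N−1, k ≤ N₁ and k ≤ N₂. Then the matrix γ^{(k)} indexed by (Fin k → Fin 2) with entries γ^{(k)}(σ,τ) = Σ_{j=0}^{k} (binom(N₁,k−j)·binom(N₂,j)/binom(N,k)) · v_{k,j}(σ) · conj(v_{k,j}(τ)) has rank exactly k+1. -/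
open scoped BigOperators
open ComplexConjugate

noncomputable section

/-- A diagonal matrix with nonzero entries, pulled back along a surjection onto its index type,
has rank equal to the size of the diagonal matrix. -/
theorem rank_diagonal_submatrix_of_surjective {K m n : Type*} [Field K] [Fintype m] [Fintype n]
    [DecidableEq n] (d : n → K) (hd : ∀ i, d i ≠ 0) (f : m → n)
    (hf : Function.Surjective f) :
    ((Matrix.diagonal d).submatrix f f).rank = Fintype.card n := by
  have hrank : (Matrix.diagonal d).rank = Fintype.card n :=
    Matrix.rank_of_isUnit _ (by
      rw [Matrix.isUnit_diagonal, Pi.isUnit_iff]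
      exact fun i => (hd i).isUnit)
  obtain ⟨s, hs⟩ := hf.hasRightInverse
  apply le_antisymm
  · exact (Matrix.rank_submatrix_le _ _ _).trans hrank.le
  · have h : ((Matrix.diagonal d).submatrix f f).submatrix s s = Matrix.diagonal d := by
      ext i j
      simp [hs i, hs j]
    rw [← hrank]
    conv_lhs => rw [← h]
    exact Matrix.rank_submatrix_le _ _ _

theorem exists_cnt_eq {m j : ℕ} (hj : j ≤ m) : ∃ σ : Fin m → Fin 2, cnt σ = j := by
  obtain ⟨s, -, hs⟩ := Finset.exists_subset_card_eq (s := (Finset.univ : Finset (Fin m)))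
    (n := j) (by simpa using hj)
  refine ⟨fun i => if i ∈ s then 1 else 0, ?_⟩
  simp [cnt, hs]

theorem vkj_mul_conj {k : ℕ} (j : ℕ) (σ τ : Fin k → Fin 2) :
    vkj k j σ * conj (vkj k j τ) =
      if cnt σ = j ∧ cnt τ = j then ((k.choose j : ℂ))⁻¹ else 0 := by
  have h : ((Real.sqrt (k.choose j) : ℝ) : ℂ) * (Real.sqrt (k.choose j) : ℝ) = k.choose j := by
    rw [← Complex.ofReal_mul, Real.mul_self_sqrt (Nat.cast_nonneg _), Complex.ofReal_natCast]
  by_cases hσ : cnt σ = j <;> by_cases hτ : cnt τ = j <;> simp [vkj, hσ, hτ, ← mul_inv, h]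

/-- the `k`-body reduced density matrix
`γ^{(k)} = Σ_{j=0}^{k} (binom(N₁,k−j)binom(N₂,j)/binom(N,k)) |v_{k,j}⟩⟨v_{k,j}|`
of the fragmented state `φ₁^{⊗N₁} ∨ φ₂^{⊗N₂}` has rank exactly `k+1`. -/
theorem stmt11 (N N₁ N₂ k : ℕ) (hN : N₁ + N₂ = N) (hk1 : 1 ≤ k) (hkN : k ≤ N - 1)
    (h1 : k ≤ N₁) (h2 : k ≤ N₂) :
    (Matrix.of fun σ τ : Fin k → Fin 2 =>
        ∑ j ∈ Finset.range (k + 1),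
          ((((N₁.choose (k - j) : ℝ) * (N₂.choose j : ℝ) / (N.choose k : ℝ)) : ℝ) : ℂ)
            * vkj k j σ * conj (vkj k j τ)).rank = k + 1 := by
  let d : Fin (k + 1) → ℂ := fun j =>
    ((((N₁.choose (k - j) : ℝ) * (N₂.choose j : ℝ) / (N.choose k : ℝ)) : ℝ) : ℂ)
      * ((k.choose j : ℂ))⁻¹
  let f : (Fin k → Fin 2) → Fin (k + 1) := fun σ => ⟨cnt σ, Nat.lt_succ_of_le (cnt_le σ)⟩
  have hd : ∀ j, d j ≠ 0 := by
    intro j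
    have hj : (j : ℕ) ≤ k := Nat.le_of_lt_succ j.isLt
    have hN₁ : N₁.choose (k - j) ≠ 0 := (Nat.choose_pos (by omega)).ne'
    have hN₂ : N₂.choose j ≠ 0 := (Nat.choose_pos (by omega)).ne'
    have hNk : N.choose k ≠ 0 := (Nat.choose_pos (by omega)).ne'
    have hkj : k.choose j ≠ 0 := (Nat.choose_pos hj).ne'
    simp [d, hN₁, hN₂, hNk, hkj]
  have hf : Function.Surjective f := fun j =>
    (exists_cnt_eq (Nat.le_of_lt_succ j.isLt)).imp fun σ hσ => Fin.ext hσ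
  refine Eq.trans (congrArg Matrix.rank ?_)
    ((rank_diagonal_submatrix_of_surjective d hd f hf).trans (Fintype.card_fin (k + 1)))
  ext σ τ
  simp only [Matrix.of_apply, Matrix.submatrix_apply, mul_assoc, vkj_mul_conj]
  rw [Finset.sum_eq_single_of_mem (cnt σ) (Finset.mem_range.2 (f σ).isLt)
    fun j _ hj => by simp [hj.symm]]
  by_cases h : cnt σ = cnt τ
  · simp [f, d, h]
  · simp [f, h, Ne.symm h]

end
end
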